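/- arXiv:2012.01020 — 5 statements merged into one kernel-verified Lean document; each statement's English description precedes it below -/
import Mathlib

section
/- Suppose the transition kernel p is Lipschitz in z with constant K¹ > 0, i.e. |p(y|x,u,z₁) − p(y|x,u,z₂)| ≤ K¹‖z₁−z₂‖∞ for all x,y ∈ 𝒳, u ∈ 𝒰, z₁,z₂ ∈ I(𝒳). Then for every γ ∈ 𝒢 and every z₁, z₂ ∈ I(𝒳), ‖f̂(z₁,γ) − f̂(z₂,γ)‖∞ ≤ |𝒳|·(1 + K¹)·‖z₁ − z₂‖∞; in particular f̂(·,γ) is Lipschitz on I(𝒳). -/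
open Finset

noncomputable section

variable {X U W : Type*}

/-- `z ∈ I(𝒳)`: componentwise in `[0,1]`. -/
def inI (z : X → ℝ) : Prop := ∀ x, 0 ≤ z x ∧ z x ≤ 1

/-- `z ∈ Δ(𝒳)`: the probability simplex on `X`. -/
def inDelta [Fintype X] (z : X → ℝ) : Prop := inI z ∧ ∑ x, z x = 1

/-- `m ∈ M_n`: empirical distributions of `n` points. -/
def inMn [Fintype X] (n : ℕ) (m : X → ℝ) : Prop :=
  inDelta m ∧ ∀ x, ∃ k : ℤ, (n : ℝ) * m x = (k : ℝ)

/-- transition kernel `p(y|x,u,z) = Σ_w 1(f(x,u,z,w)=y)·P_W(w)`. -/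
def ker [DecidableEq X] [Fintype W] (f : X → U → (X → ℝ) → W → X) (Pw : W → ℝ)
    (y x : X) (u : U) (z : X → ℝ) : ℝ :=
  ∑ w, if f x u z w = y then Pw w else 0

/-- deterministic mean-field update `f̂(z,γ)(y) = Σ_x z(x)·p(y|x,γ(x),z)`. -/
def fhat [Fintype X] [DecidableEq X] [Fintype W] (f : X → U → (X → ℝ) → W → X)
    (Pw : W → ℝ) (z : X → ℝ) (γ : X → U) : X → ℝ :=
  fun y => ∑ x, z x * ker f Pw y x (γ x) z

/-- expected per-step cost `ĉ(z,γ) = Σ_x z(x)·ℓ(x,γ(x),z)`. -/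
def chat [Fintype X] (ℓ : X → U → (X → ℝ) → ℝ) (z : X → ℝ) (γ : X → U) : ℝ :=
  ∑ x, z x * ℓ x (γ x) z

/-- empirical distribution of `n` points of `X`. -/
def emp [Fintype X] [DecidableEq X] {n : ℕ} (x : Fin n → X) : X → ℝ :=
  fun y => (1 / (n : ℝ)) * ∑ i, if x i = y then (1 : ℝ) else 0

/-- empirical distribution of the noise vector `ω`. -/
def ehat [DecidableEq W] {n : ℕ} (ω : Fin n → W) (w : W) : ℝ :=
  (1 / (n : ℝ)) * ∑ i, if ω i = w then (1 : ℝ) else 0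

/-- empirical mean-field update
`f̄(m,γ,𝐰)(y) = Σ_x Σ_w 1(f(x,γ(x),m,w)=y)·m(x)·ê_𝐰(w)`. -/
def fbar [Fintype X] [DecidableEq X] [Fintype W] [DecidableEq W] {n : ℕ}
    (f : X → U → (X → ℝ) → W → X) (m : X → ℝ) (γ : X → U) (ω : Fin n → W) : X → ℝ :=
  fun y => ∑ x, ∑ w, (if f x (γ x) m w = y then (1 : ℝ) else 0) * m x * ehat ω w

theorem stmt0 [Fintype X] [Nonempty X] [DecidableEq X] [Fintype U] [Nonempty U]
    [Fintype W] [Nonempty W]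
    (Pw : W → ℝ) (hPw0 : ∀ w, 0 ≤ Pw w) (hPw1 : ∑ w, Pw w = 1)
    (f : X → U → (X → ℝ) → W → X) (K1 : ℝ) (hK1 : 0 < K1)
    (hpLip : ∀ (x y : X) (u : U) (z₁ z₂ : X → ℝ), inI z₁ → inI z₂ →
      |ker f Pw y x u z₁ - ker f Pw y x u z₂| ≤ K1 * ‖z₁ - z₂‖) :
    ∀ (γ : X → U) (z₁ z₂ : X → ℝ), inI z₁ → inI z₂ →
      ‖fhat f Pw z₁ γ - fhat f Pw z₂ γ‖ ≤ (Fintype.card X : ℝ) * (1 + K1) * ‖z₁ - z₂‖ := by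
  intro γ z₁ z₂ h1 h2
  have hN : 0 ≤ ‖z₁ - z₂‖ := norm_nonneg _
  rw [pi_norm_le_iff_of_nonneg (by positivity)]
  intro y
  have hk0 : ∀ x, 0 ≤ ker f Pw y x (γ x) z₁ := by
    intro x
    unfold ker
    refine Finset.sum_nonneg fun w _ => ?_
    split_ifs
    · exact hPw0 w
    · exact le_rfl
  have hk1 : ∀ x, ker f Pw y x (γ x) z₁ ≤ 1 := by
    intro x
    unfold ker
    rw [← hPw1]
    refine Finset.sum_le_sum fun w _ => ?_
    split_ifs
    · exact le_rfl
    · exact hPw0 w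
  have hx : ∀ x, |z₁ x * ker f Pw y x (γ x) z₁ - z₂ x * ker f Pw y x (γ x) z₂|
      ≤ (1 + K1) * ‖z₁ - z₂‖ := by
    intro x
    have e : z₁ x * ker f Pw y x (γ x) z₁ - z₂ x * ker f Pw y x (γ x) z₂
        = (z₁ x - z₂ x) * ker f Pw y x (γ x) z₁
          + z₂ x * (ker f Pw y x (γ x) z₁ - ker f Pw y x (γ x) z₂) := by ring
    have hz : |z₁ x - z₂ x| ≤ ‖z₁ - z₂‖ := norm_le_pi_norm (z₁ - z₂) x
    have hp := hpLip x y (γ x) z₁ z₂ h1 h2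
    rw [e]
    refine (abs_add_le _ _).trans ?_
    rw [abs_mul, abs_mul, abs_of_nonneg (hk0 x), abs_of_nonneg (h2 x).1]
    have a1 := mul_le_mul hz (hk1 x) (hk0 x) hN
    have a2 := mul_le_mul (h2 x).2 hp (abs_nonneg _) zero_le_one
    linarith
  rw [Pi.sub_apply, Real.norm_eq_abs]
  unfold fhat
  rw [← Finset.sum_sub_distrib]
  refine (Finset.abs_sum_le_sum_abs _ _).trans ?_
  refine (Finset.sum_le_sum fun x _ => hx x).trans ?_
  rw [Finset.sum_const, Finset.card_univ, nsmul_eq_mul, mul_assoc]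
end
end

section
/- Suppose the per-step cost ℓ is Lipschitz in z with constant K² > 0, i.e. |ℓ(x,u,z₁) − ℓ(x,u,z₂)| ≤ K²‖z₁−z₂‖∞ for all x ∈ 𝒳, u ∈ 𝒰, z₁,z₂ ∈ I(𝒳), and is bounded: ℓ(x,u,z) ≤ L for all x, u, z. Then for every γ ∈ 𝒢 and every z₁, z₂ ∈ I(𝒳), |ĉ(z₁,γ) − ĉ(z₂,γ)| ≤ |𝒳|·(L + K²)·‖z₁ − z₂‖∞; in particular ĉ(·,γ) is Lipschitz on I(𝒳). -/
open Finset

noncomputable section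

variable {X U W : Type*}

theorem stmt1 [Fintype X] [Nonempty X] [Fintype U] [Nonempty U]
    (ℓ : X → U → (X → ℝ) → ℝ) (hℓ0 : ∀ x u z, inI z → 0 ≤ ℓ x u z)
    (K2 L : ℝ) (hK2 : 0 < K2)
    (hℓLip : ∀ (x : X) (u : U) (z₁ z₂ : X → ℝ), inI z₁ → inI z₂ →
      |ℓ x u z₁ - ℓ x u z₂| ≤ K2 * ‖z₁ - z₂‖)
    (hℓBd : ∀ x u z, inI z → ℓ x u z ≤ L) :
    ∀ (γ : X → U) (z₁ z₂ : X → ℝ), inI z₁ → inI z₂ →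
      |chat ℓ z₁ γ - chat ℓ z₂ γ| ≤ (Fintype.card X : ℝ) * (L + K2) * ‖z₁ - z₂‖ := by
  intro γ z₁ z₂ h₁ h₂
  have key : ∀ x ∈ (Finset.univ : Finset X),
      |z₁ x * ℓ x (γ x) z₁ - z₂ x * ℓ x (γ x) z₂| ≤ (L + K2) * ‖z₁ - z₂‖ := by
    intro x _
    have hz : |z₁ x - z₂ x| ≤ ‖z₁ - z₂‖ := by
      simpa using norm_le_pi_norm (z₁ - z₂) x
    have e : z₁ x * ℓ x (γ x) z₁ - z₂ x * ℓ x (γ x) z₂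
        = (z₁ x - z₂ x) * ℓ x (γ x) z₁ + z₂ x * (ℓ x (γ x) z₁ - ℓ x (γ x) z₂) := by ring
    have a0 := hℓ0 x (γ x) z₁ h₁
    have a1 := hℓBd x (γ x) z₁ h₁
    have a2 := hℓLip x (γ x) z₁ z₂ h₁ h₂
    have b1 : |(z₁ x - z₂ x) * ℓ x (γ x) z₁| ≤ ‖z₁ - z₂‖ * L := by
      rw [abs_mul, abs_of_nonneg a0]
      exact mul_le_mul hz a1 a0 (norm_nonneg _)
    have b2 : |z₂ x * (ℓ x (γ x) z₁ - ℓ x (γ x) z₂)| ≤ 1 * (K2 * ‖z₁ - z₂‖) := by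
      rw [abs_mul, abs_of_nonneg (h₂ x).1]
      exact mul_le_mul (h₂ x).2 a2 (abs_nonneg _) zero_le_one
    rw [e]
    refine (abs_add_le _ _).trans ?_
    linarith
  unfold chat
  rw [← Finset.sum_sub_distrib]
  refine (Finset.abs_sum_le_sum_abs _ _).trans ((Finset.sum_le_sum key).trans (le_of_eq ?_))
  rw [Finset.sum_const, Finset.card_univ, nsmul_eq_mul, mul_assoc]
end
end

section
/- Assume p is Lipschitz in z with constant K¹ > 0 and ℓ is Lipschitz in z with constant K² > 0 and bounded by L (as in the context), and set K³ := |𝒳|·(1+K¹) and K⁴ := |𝒳|·(L+K²). If Ŵ : Δ(𝒳) → ℝ satisfies |Ŵ(z₁) − Ŵ(z₂)| ≤ K′·‖z₁−z₂‖∞ for all z₁,z₂ ∈ Δ(𝒳) and some K′ ≥ 0, then the one-step Bellman image T̂Ŵ(z) := min_{γ∈𝒢} ( ĉ(z,γ) + Ŵ(f̂(z,γ)) ) satisfies |T̂Ŵ(z₁) − T̂Ŵ(z₂)| ≤ (K⁴ + K′·K³)·‖z₁ − z₂‖∞ for all z₁, z₂ ∈ Δ(𝒳). -/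
open Finset

noncomputable section

variable {X U W : Type*}

theorem aux_sum [Fintype X] (z₁ z₂ a₁ a₂ : X → ℝ) (B K : ℝ) (h2 : inI z₂)
    (ha0 : ∀ x, 0 ≤ a₁ x) (haB : ∀ x, a₁ x ≤ B)
    (hd : ∀ x, |a₁ x - a₂ x| ≤ K * ‖z₁ - z₂‖) :
    |∑ x, z₁ x * a₁ x - ∑ x, z₂ x * a₂ x| ≤
      ((Fintype.card X : ℝ) * (B + K)) * ‖z₁ - z₂‖ := by
  rw [← Finset.sum_sub_distrib]
  refine (Finset.abs_sum_le_sum_abs _ _).trans ?_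
  have key : ∀ x ∈ (Finset.univ : Finset X),
      |z₁ x * a₁ x - z₂ x * a₂ x| ≤ (B + K) * ‖z₁ - z₂‖ := by
    intro x _
    have hn : |z₁ x - z₂ x| ≤ ‖z₁ - z₂‖ := by
      have := norm_le_pi_norm (z₁ - z₂) x
      simpa using this
    have e : z₁ x * a₁ x - z₂ x * a₂ x = (z₁ x - z₂ x) * a₁ x + z₂ x * (a₁ x - a₂ x) := by ring
    rw [e]
    refine (abs_add_le _ _).trans ?_
    rw [abs_mul, abs_mul, abs_of_nonneg (ha0 x), abs_of_nonneg (h2 x).1]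
    have t1 : |z₁ x - z₂ x| * a₁ x ≤ ‖z₁ - z₂‖ * B :=
      mul_le_mul hn (haB x) (ha0 x) (norm_nonneg _)
    have t2 : z₂ x * |a₁ x - a₂ x| ≤ 1 * (K * ‖z₁ - z₂‖) :=
      mul_le_mul (h2 x).2 (hd x) (abs_nonneg _) zero_le_one
    linarith
  refine (Finset.sum_le_sum key).trans ?_
  rw [Finset.sum_const, Finset.card_univ, nsmul_eq_mul]
  exact le_of_eq (by ring)

theorem aux_ker_nonneg [DecidableEq X] [Fintype W] (f : X → U → (X → ℝ) → W → X) (Pw : W → ℝ)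
    (hPw0 : ∀ w, 0 ≤ Pw w) (y x : X) (u : U) (z : X → ℝ) : 0 ≤ ker f Pw y x u z := by
  unfold ker
  refine Finset.sum_nonneg fun w _ => ?_
  split_ifs
  · exact hPw0 w
  · exact le_rfl

theorem aux_ker_le [DecidableEq X] [Fintype W] (f : X → U → (X → ℝ) → W → X) (Pw : W → ℝ)
    (hPw0 : ∀ w, 0 ≤ Pw w) (hPw1 : ∑ w, Pw w = 1)
    (y x : X) (u : U) (z : X → ℝ) : ker f Pw y x u z ≤ 1 := by
  unfold ker
  rw [← hPw1]
  refine Finset.sum_le_sum fun w _ => ?_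
  split_ifs
  · exact le_rfl
  · exact hPw0 w

theorem aux_fhat [Fintype X] [DecidableEq X] [Fintype W] (f : X → U → (X → ℝ) → W → X)
    (Pw : W → ℝ) (hPw0 : ∀ w, 0 ≤ Pw w) (hPw1 : ∑ w, Pw w = 1)
    (z : X → ℝ) (γ : X → U) (hz : inDelta z) : inDelta (fhat f Pw z γ) := by
  have hs : ∀ x, ∑ y, ker f Pw y x (γ x) z = 1 := by
    intro x
    unfold ker
    rw [Finset.sum_comm]
    simpa using hPw1
  refine ⟨fun y => ⟨?_, ?_⟩, ?_⟩
  · exact Finset.sum_nonneg fun x _ => mul_nonneg (hz.1 x).1 (aux_ker_nonneg f Pw hPw0 _ _ _ _)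
  · rw [← hz.2]
    exact Finset.sum_le_sum fun x _ =>
      mul_le_of_le_one_right (hz.1 x).1 (aux_ker_le f Pw hPw0 hPw1 _ _ _ _)
  · unfold fhat
    rw [Finset.sum_comm, ← hz.2]
    refine Finset.sum_congr rfl fun x _ => ?_
    rw [← Finset.mul_sum, hs, mul_one]

theorem aux_inf {ι : Type*} [Finite ι] [Nonempty ι] (a b : ι → ℝ) (C : ℝ)
    (h : ∀ i, |a i - b i| ≤ C) : |(⨅ i, a i) - (⨅ i, b i)| ≤ C := by
  have ba := (Set.finite_range a).bddBelow
  have bb := (Set.finite_range b).bddBelow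
  have h1 : (⨅ i, a i) - C ≤ ⨅ i, b i := le_ciInf fun i => by
    have := ciInf_le ba i
    have := (abs_le.1 (h i)).2
    linarith
  have h2 : (⨅ i, b i) - C ≤ ⨅ i, a i := le_ciInf fun i => by
    have := ciInf_le bb i
    have := (abs_le.1 (h i)).1
    linarith
  exact abs_le.2 ⟨by linarith, by linarith⟩

theorem stmt4 [Fintype X] [Nonempty X] [DecidableEq X] [Fintype U] [Nonempty U]
    [Fintype W] [Nonempty W]
    (Pw : W → ℝ) (hPw0 : ∀ w, 0 ≤ Pw w) (hPw1 : ∑ w, Pw w = 1)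
    (f : X → U → (X → ℝ) → W → X)
    (ℓ : X → U → (X → ℝ) → ℝ) (hℓ0 : ∀ x u z, inI z → 0 ≤ ℓ x u z)
    (K1 K2 L : ℝ) (hK1 : 0 < K1) (hK2 : 0 < K2)
    (hpLip : ∀ (x y : X) (u : U) (z₁ z₂ : X → ℝ), inI z₁ → inI z₂ →
      |ker f Pw y x u z₁ - ker f Pw y x u z₂| ≤ K1 * ‖z₁ - z₂‖)
    (hℓLip : ∀ (x : X) (u : U) (z₁ z₂ : X → ℝ), inI z₁ → inI z₂ →
      |ℓ x u z₁ - ℓ x u z₂| ≤ K2 * ‖z₁ - z₂‖)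
    (hℓBd : ∀ x u z, inI z → ℓ x u z ≤ L)
    (What : (X → ℝ) → ℝ) (K' : ℝ) (hK' : 0 ≤ K')
    (hWLip : ∀ z₁ z₂ : X → ℝ, inDelta z₁ → inDelta z₂ →
      |What z₁ - What z₂| ≤ K' * ‖z₁ - z₂‖) :
    ∀ z₁ z₂ : X → ℝ, inDelta z₁ → inDelta z₂ →
      |(⨅ γ : X → U, (chat ℓ z₁ γ + What (fhat f Pw z₁ γ))) -
          (⨅ γ : X → U, (chat ℓ z₂ γ + What (fhat f Pw z₂ γ)))|
        ≤ ((Fintype.card X : ℝ) * (L + K2) + K' * ((Fintype.card X : ℝ) * (1 + K1))) *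
            ‖z₁ - z₂‖ := by
  intro z₁ z₂ h1 h2
  refine aux_inf _ _ _ fun γ => ?_
  have c1 : |chat ℓ z₁ γ - chat ℓ z₂ γ| ≤
      ((Fintype.card X : ℝ) * (L + K2)) * ‖z₁ - z₂‖ :=
    aux_sum z₁ z₂ (fun x => ℓ x (γ x) z₁) (fun x => ℓ x (γ x) z₂) L K2 h2.1
      (fun x => hℓ0 _ _ _ h1.1) (fun x => hℓBd _ _ _ h1.1)
      (fun x => hℓLip _ _ _ _ h1.1 h2.1)
  have c2 : ‖fhat f Pw z₁ γ - fhat f Pw z₂ γ‖ ≤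
      ((Fintype.card X : ℝ) * (1 + K1)) * ‖z₁ - z₂‖ := by
    refine (pi_norm_le_iff_of_nonneg (by positivity)).2 fun y => ?_
    exact aux_sum z₁ z₂ (fun x => ker f Pw y x (γ x) z₁) (fun x => ker f Pw y x (γ x) z₂) 1 K1 h2.1
      (fun x => aux_ker_nonneg f Pw hPw0 _ _ _ _) (fun x => aux_ker_le f Pw hPw0 hPw1 _ _ _ _)
      (fun x => hpLip _ _ _ _ _ h1.1 h2.1)
  have c3 := hWLip _ _ (aux_fhat f Pw hPw0 hPw1 z₁ γ h1) (aux_fhat f Pw hPw0 hPw1 z₂ γ h2)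
  have c4 := mul_le_mul_of_nonneg_left c2 hK'
  rw [add_sub_add_comm]
  refine (abs_add_le _ _).trans ?_
  linarith
end
end

section
/- For every n ≥ 1, every m ∈ Δ(𝒳), every γ ∈ 𝒢, and 𝐖 = (W¹,…,Wⁿ) with components i.i.d. with pmf P_W, one has E[ ‖ f̄(m,γ,𝐖) − f̂(m,γ) ‖∞ ] ≤ |𝒳|·|𝒲| / √n. -/
open Finset

noncomputable section

variable {X U W : Type*}

theorem aux_jensen {ι : Type*} [Fintype ι] (p a : ι → ℝ) (hp : ∀ i, 0 ≤ p i)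
    (h1 : ∑ i, p i = 1) : (∑ i, p i * a i) ^ 2 ≤ ∑ i, p i * a i ^ 2 := by
  have h : 0 ≤ ∑ i, p i * (a i - ∑ j, p j * a j) ^ 2 :=
    Finset.sum_nonneg fun i _ => mul_nonneg (hp i) (sq_nonneg _)
  have e : ∀ s : ℝ, ∑ i, p i * (a i - s) ^ 2
      = ∑ i, p i * a i ^ 2 - 2 * s * (∑ i, p i * a i) + s ^ 2 * ∑ i, p i := by
    intro s
    rw [Finset.mul_sum, Finset.mul_sum, ← Finset.sum_sub_distrib, ← Finset.sum_add_distrib]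
    exact Finset.sum_congr rfl fun i _ => by ring
  rw [e, h1] at h
  nlinarith

theorem aux_cons [Fintype W] (n : ℕ) (F : (Fin (n+1) → W) → ℝ) :
    ∑ ω : Fin (n+1) → W, F ω = ∑ a : W, ∑ ω : Fin n → W, F (Fin.cons a ω) := by
  rw [← (Fin.consEquiv (fun _ : Fin (n+1) => W)).sum_comp, Fintype.sum_prod_type]
  rfl

theorem aux_mass [Fintype W] (Pw : W → ℝ) (hPw1 : ∑ w, Pw w = 1) (n : ℕ) :
    ∑ ω : Fin n → W, (∏ i, Pw (ω i)) = 1 := by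
  induction n with
  | zero => simp
  | succ k ih =>
    rw [aux_cons]
    simp only [Fin.prod_univ_succ, Fin.cons_zero, Fin.cons_succ, ← Finset.mul_sum, ih]
    simpa using hPw1

theorem aux_mean [Fintype W] (Pw : W → ℝ) (hPw1 : ∑ w, Pw w = 1) (g : W → ℝ)
    (hg : ∑ w, Pw w * g w = 0) (n : ℕ) :
    ∑ ω : Fin n → W, (∏ i, Pw (ω i)) * ∑ i, g (ω i) = 0 := by
  induction n with
  | zero => simp
  | succ k ih =>
    rw [aux_cons]
    simp only [Fin.prod_univ_succ, Fin.sum_univ_succ, Fin.cons_zero, Fin.cons_succ]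
    have : ∀ a : W, ∑ ω : Fin k → W, (Pw a * ∏ i, Pw (ω i)) * (g a + ∑ i, g (ω i))
        = Pw a * g a := by
      intro a
      calc _ = Pw a * g a * (∑ ω : Fin k → W, ∏ i, Pw (ω i))
            + Pw a * ∑ ω : Fin k → W, (∏ i, Pw (ω i)) * ∑ i, g (ω i) := by
            rw [Finset.mul_sum, Finset.mul_sum, ← Finset.sum_add_distrib]
            exact Finset.sum_congr rfl fun ω _ => by ring
        _ = _ := by rw [ih, aux_mass Pw hPw1]; ring
    simp only [this, hg]

theorem aux_sq [Fintype W] (Pw : W → ℝ) (hPw1 : ∑ w, Pw w = 1) (g : W → ℝ)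
    (hg : ∑ w, Pw w * g w = 0) (n : ℕ) :
    ∑ ω : Fin n → W, (∏ i, Pw (ω i)) * (∑ i, g (ω i)) ^ 2 = n * ∑ w, Pw w * g w ^ 2 := by
  induction n with
  | zero => simp
  | succ k ih =>
    rw [aux_cons]
    simp only [Fin.prod_univ_succ, Fin.sum_univ_succ, Fin.cons_zero, Fin.cons_succ]
    have : ∀ a : W, ∑ ω : Fin k → W, (Pw a * ∏ i, Pw (ω i)) * (g a + ∑ i, g (ω i)) ^ 2
        = Pw a * g a ^ 2 + Pw a * (k * ∑ w, Pw w * g w ^ 2) := by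
      intro a
      calc _ = Pw a * g a ^ 2 * (∑ ω : Fin k → W, ∏ i, Pw (ω i))
            + 2 * Pw a * g a * (∑ ω : Fin k → W, (∏ i, Pw (ω i)) * ∑ i, g (ω i))
            + Pw a * ∑ ω : Fin k → W, (∏ i, Pw (ω i)) * (∑ i, g (ω i)) ^ 2 := by
            rw [Finset.mul_sum, Finset.mul_sum, Finset.mul_sum, ← Finset.sum_add_distrib,
              ← Finset.sum_add_distrib]
            exact Finset.sum_congr rfl fun ω _ => by ring
        _ = _ := by rw [ih, aux_mass Pw hPw1, aux_mean Pw hPw1 g hg]; ring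
    simp only [this, Finset.sum_add_distrib, ← Finset.sum_mul, hPw1]
    push_cast; ring

theorem aux_dev [Fintype W] [DecidableEq W] (Pw : W → ℝ) (hPw0 : ∀ w, 0 ≤ Pw w)
    (hPw1 : ∑ w, Pw w = 1) (n : ℕ) (hn : 1 ≤ n) (w : W) :
    ∑ ω : Fin n → W, (∏ i, Pw (ω i)) * |ehat ω w - Pw w| ≤ 1 / Real.sqrt n := by
  have hn0 : (0 : ℝ) < n := by exact_mod_cast hn
  have hle : ∀ v, Pw v ≤ 1 := fun v => by
    rw [← hPw1]; exact Finset.single_le_sum (fun i _ => hPw0 i) (Finset.mem_univ v)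
  set g : W → ℝ := fun v => (if v = w then (1 : ℝ) else 0) - Pw w with hgdef
  have hg : ∑ v, Pw v * g v = 0 := by
    simp [hgdef, mul_sub, Finset.sum_sub_distrib, ← Finset.sum_mul, hPw1]
  have hv : ∑ v, Pw v * g v ^ 2 ≤ 1 := by
    rw [← hPw1]
    refine Finset.sum_le_sum fun v _ => mul_le_of_le_one_right (hPw0 v) ?_
    have h0 := hPw0 w
    have h1 := hle w
    simp only [hgdef]
    split_ifs <;> nlinarith
  have he : ∀ ω : Fin n → W, ehat ω w - Pw w = (1 / (n : ℝ)) * ∑ i, g (ω i) := by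
    intro ω
    simp only [ehat, hgdef, Finset.sum_sub_distrib, Finset.sum_const, Finset.card_univ,
      Fintype.card_fin, nsmul_eq_mul]
    field_simp
  have hp : ∀ ω : Fin n → W, 0 ≤ ∏ i, Pw (ω i) := fun ω =>
    Finset.prod_nonneg fun i _ => hPw0 _
  have h2 : ∑ ω : Fin n → W, (∏ i, Pw (ω i)) * |ehat ω w - Pw w| ^ 2 ≤ 1 / n := by
    have : ∀ ω : Fin n → W, (∏ i, Pw (ω i)) * |ehat ω w - Pw w| ^ 2
        = (1 / (n : ℝ)) ^ 2 * ((∏ i, Pw (ω i)) * (∑ i, g (ω i)) ^ 2) := by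
      intro ω; rw [sq_abs, he]; ring
    simp only [this, ← Finset.mul_sum]
    rw [aux_sq Pw hPw1 g hg]
    calc _ = 1 / (n : ℝ) * ∑ v, Pw v * g v ^ 2 := by field_simp
      _ ≤ _ := mul_le_of_le_one_right (by positivity) hv
  have hJ := aux_jensen (fun ω : Fin n → W => ∏ i, Pw (ω i)) (fun ω => |ehat ω w - Pw w|) hp
    (aux_mass Pw hPw1 n)
  rw [one_div, ← Real.sqrt_inv, ← one_div]
  exact Real.le_sqrt_of_sq_le (hJ.trans h2)

theorem aux_point [Fintype X] [DecidableEq X] [Fintype W] [DecidableEq W]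
    (Pw : W → ℝ) (f : X → U → (X → ℝ) → W → X)
    (n : ℕ) (m : X → ℝ) (hm : inDelta m) (γ : X → U) (ω : Fin n → W) :
    ‖fbar f m γ ω - fhat f Pw m γ‖ ≤ ∑ w, |ehat ω w - Pw w| := by
  rw [pi_norm_le_iff_of_nonneg (Finset.sum_nonneg fun _ _ => abs_nonneg _)]
  intro y
  have h : (fbar f m γ ω - fhat f Pw m γ) y = ∑ x, m x *
      ∑ w, (if f x (γ x) m w = y then (1 : ℝ) else 0) * (ehat ω w - Pw w) := by
    simp only [Pi.sub_apply, fbar, fhat, ker, ← Finset.sum_sub_distrib, Finset.mul_sum]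
    refine Finset.sum_congr rfl fun x _ => Finset.sum_congr rfl fun w _ => ?_
    split_ifs <;> ring
  rw [h, Real.norm_eq_abs]
  calc _ ≤ ∑ x, m x * ∑ w, |ehat ω w - Pw w| := by
        refine (Finset.abs_sum_le_sum_abs _ _).trans (Finset.sum_le_sum fun x _ => ?_)
        rw [abs_mul, abs_of_nonneg (hm.1 x).1]
        refine mul_le_mul_of_nonneg_left ?_ (hm.1 x).1
        refine (Finset.abs_sum_le_sum_abs _ _).trans (Finset.sum_le_sum fun w _ => ?_)
        split_ifs <;> simp
    _ = _ := by rw [← Finset.sum_mul, hm.2, one_mul]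

theorem stmt7 [Fintype X] [Nonempty X] [DecidableEq X] [Fintype U] [Nonempty U]
    [Fintype W] [Nonempty W] [DecidableEq W]
    (Pw : W → ℝ) (hPw0 : ∀ w, 0 ≤ Pw w) (hPw1 : ∑ w, Pw w = 1)
    (f : X → U → (X → ℝ) → W → X)
    (n : ℕ) (hn : 1 ≤ n) (m : X → ℝ) (hm : inDelta m) (γ : X → U) :
    ∑ ω : Fin n → W, (∏ i, Pw (ω i)) * ‖fbar f m γ ω - fhat f Pw m γ‖
      ≤ (Fintype.card X : ℝ) * (Fintype.card W : ℝ) / Real.sqrt n := by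
  have hX : (1 : ℝ) ≤ Fintype.card X := by exact_mod_cast Fintype.card_pos
  calc _ ≤ ∑ ω : Fin n → W, (∏ i, Pw (ω i)) * ∑ w, |ehat ω w - Pw w| :=
        Finset.sum_le_sum fun ω _ => mul_le_mul_of_nonneg_left
          (aux_point Pw f n m hm γ ω) (Finset.prod_nonneg fun i _ => hPw0 _)
    _ = ∑ w, ∑ ω : Fin n → W, (∏ i, Pw (ω i)) * |ehat ω w - Pw w| := by
        simp only [Finset.mul_sum]; exact Finset.sum_comm
    _ ≤ ∑ _w : W, 1 / Real.sqrt n :=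
        Finset.sum_le_sum fun w _ => aux_dev Pw hPw0 hPw1 n hn w
    _ = 1 * (Fintype.card W : ℝ) / Real.sqrt n := by simp [div_eq_mul_inv]
    _ ≤ _ := by gcongr
end
end

section
/- Assume p is Lipschitz in z with constant K¹ > 0, i.e. |p(y|x,u,z₁) − p(y|x,u,z₂)| ≤ K¹‖z₁−z₂‖∞ for all x,y ∈ 𝒳, u ∈ 𝒰, z₁,z₂ ∈ I(𝒳). Then for every n ≥ 1, every m ∈ Δ(𝒳), every z ∈ Δ(𝒳), every γ ∈ 𝒢, and 𝐖 = (W¹,…,Wⁿ) with components i.i.d. with pmf P_W, one has E[ ‖ f̄(m,γ,𝐖) − f̂(z,γ) ‖∞ ] ≤ |𝒳|·(1+K¹)·‖m − z‖∞ + |𝒳|·|𝒲|/√n. -/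
open Finset

noncomputable section

variable {X U W : Type*}

lemma s9_cons {W : Type*} [Fintype W] (n : ℕ) (F : (Fin (n+1) → W) → ℝ) :
    ∑ ω : Fin (n+1) → W, F ω = ∑ a : W, ∑ ω : Fin n → W, F (Fin.cons a ω) := by
  rw [← (Fin.consEquiv (fun _ : Fin (n+1) => W)).sum_comp, Fintype.sum_prod_type]
  rfl

lemma s9_zero {W : Type*} [Fintype W] (P : W → ℝ) (h1 : ∑ w, P w = 1) (n : ℕ) :
    ∑ ω : Fin n → W, ∏ i, P (ω i) = 1 := by
  induction n with
  | zero => simp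
  | succ n ih =>
    rw [s9_cons]
    simp only [Fin.prod_univ_succ, Fin.cons_zero, Fin.cons_succ]
    simp only [← Finset.mul_sum, ih, mul_one, h1]

lemma s9_two {W : Type*} [Fintype W] (P g : W → ℝ) (h1 : ∑ w, P w = 1)
    (hg : ∑ w, P w * g w = 0) (n : ℕ) :
    ∑ ω : Fin n → W, (∏ i, P (ω i)) * (∑ i, g (ω i)) ^ 2 = n * ∑ w, P w * g w ^ 2 := by
  induction n with
  | zero => simp
  | succ n ih =>
    rw [s9_cons]
    simp only [Fin.prod_univ_succ, Fin.sum_univ_succ, Fin.cons_zero, Fin.cons_succ]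
    have h0 := s9_zero P h1 n
    have key : ∀ a : W, ∑ ω : Fin n → W, P a * (∏ i, P (ω i)) * (g a + ∑ i, g (ω i)) ^ 2
        = P a * g a ^ 2 + P a * g a * (2 * ∑ ω : Fin n → W, (∏ i, P (ω i)) * ∑ i, g (ω i))
          + P a * (n * ∑ w, P w * g w ^ 2) := by
      intro a
      rw [← ih]
      have e : ∀ ω : Fin n → W, P a * (∏ i, P (ω i)) * (g a + ∑ i, g (ω i)) ^ 2
          = P a * g a ^ 2 * (∏ i, P (ω i)) + P a * g a * 2 * ((∏ i, P (ω i)) * ∑ i, g (ω i))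
            + P a * ((∏ i, P (ω i)) * (∑ i, g (ω i)) ^ 2) := by
        intro ω
        ring
      rw [Finset.sum_congr rfl fun ω _ => e ω, Finset.sum_add_distrib, Finset.sum_add_distrib,
        ← Finset.mul_sum, ← Finset.mul_sum, ← Finset.mul_sum, h0]
      ring
    rw [Finset.sum_congr rfl fun a _ => key a, Finset.sum_add_distrib, Finset.sum_add_distrib,
      ← Finset.sum_mul, ← Finset.sum_mul, hg, h1]
    push_cast
    ring

lemma s9_abs {W : Type*} [Fintype W] [DecidableEq W] (P : W → ℝ) (h0 : ∀ w, 0 ≤ P w)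
    (h1 : ∑ w, P w = 1) (n : ℕ) (hn : 1 ≤ n) (w : W) :
    ∑ ω : Fin n → W, (∏ i, P (ω i)) * |ehat ω w - P w| ≤ 1 / Real.sqrt n := by
  have hn' : (0:ℝ) < n := by exact_mod_cast hn
  set s := Real.sqrt n with hs
  have hs0 : 0 < s := Real.sqrt_pos.2 hn'
  have hss : s ^ 2 = n := Real.sq_sqrt hn'.le
  set g : W → ℝ := fun v => (if v = w then (1:ℝ) else 0) - P w with hgdef
  have hPle : P w ≤ 1 := h1 ▸ Finset.single_le_sum (fun i _ => h0 i) (Finset.mem_univ w)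
  have hg : ∑ v, P v * g v = 0 := by
    simp only [hgdef, mul_sub, Finset.sum_sub_distrib, ← Finset.sum_mul, h1]
    simp
  have hg2 : ∑ v, P v * g v ^ 2 ≤ 1 := by
    rw [← h1]
    refine Finset.sum_le_sum fun v _ => ?_
    have : g v ^ 2 ≤ 1 := by
      simp only [hgdef]
      have := h0 w
      split_ifs <;> nlinarith
    nlinarith [h0 v]
  have h2 := s9_two P g h1 hg n
  have hE : ∀ ω : Fin n → W, ehat ω w - P w = (∑ i, g (ω i)) / n := by
    intro ω
    simp only [ehat, hgdef, Finset.sum_sub_distrib, Finset.sum_const, Finset.card_univ,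
      Fintype.card_fin, nsmul_eq_mul]
    field_simp
  have hp : ∀ ω : Fin n → W, (∏ i, P (ω i)) * |ehat ω w - P w| ≤
      (∏ i, P (ω i)) * (∑ i, g (ω i)) ^ 2 * (1 / (2 * s ^ 3)) + (∏ i, P (ω i)) * (1 / (2 * s)) := by
    intro ω
    have hpos : 0 ≤ ∏ i, P (ω i) := Finset.prod_nonneg fun i _ => h0 _
    rw [hE, mul_assoc, ← mul_add]
    refine mul_le_mul_of_nonneg_left ?_ hpos
    rw [abs_div, abs_of_pos hn', ← hss, ← sq_abs (∑ i, g (ω i))]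
    generalize |∑ i, g (ω i)| = t
    have : t ^ 2 * (1 / (2 * s ^ 3)) + 1 / (2 * s) - t / s ^ 2 = (t - s) ^ 2 / (2 * s ^ 3) := by
      field_simp
      ring
    have h3 : 0 ≤ (t - s) ^ 2 / (2 * s ^ 3) := by positivity
    linarith
  refine (Finset.sum_le_sum fun ω _ => hp ω).trans ?_
  rw [Finset.sum_add_distrib, ← Finset.sum_mul, ← Finset.sum_mul, h2, s9_zero P h1 n, ← hss]
  have : s ^ 2 * (∑ v, P v * g v ^ 2) * (1 / (2 * s ^ 3)) ≤ s ^ 2 * 1 * (1 / (2 * s ^ 3)) := by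
    gcongr
  refine (add_le_add_left this _).trans (le_of_eq ?_)
  field_simp
  norm_num

theorem stmt9 [Fintype X] [Nonempty X] [DecidableEq X] [Fintype U] [Nonempty U]
    [Fintype W] [Nonempty W] [DecidableEq W]
    (Pw : W → ℝ) (hPw0 : ∀ w, 0 ≤ Pw w) (hPw1 : ∑ w, Pw w = 1)
    (f : X → U → (X → ℝ) → W → X) (K1 : ℝ) (hK1 : 0 < K1)
    (hpLip : ∀ (x y : X) (u : U) (z₁ z₂ : X → ℝ), inI z₁ → inI z₂ →
      |ker f Pw y x u z₁ - ker f Pw y x u z₂| ≤ K1 * ‖z₁ - z₂‖)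
    (n : ℕ) (hn : 1 ≤ n) (m z : X → ℝ) (hm : inDelta m) (hz : inDelta z) (γ : X → U) :
    ∑ ω : Fin n → W, (∏ i, Pw (ω i)) * ‖fbar f m γ ω - fhat f Pw z γ‖
      ≤ (Fintype.card X : ℝ) * (1 + K1) * ‖m - z‖ +
          (Fintype.card X : ℝ) * (Fintype.card W : ℝ) / Real.sqrt n := by
  classical
  have hX : (1:ℝ) ≤ Fintype.card X := by exact_mod_cast Fintype.card_pos
  have hN : 0 ≤ ‖m - z‖ := norm_nonneg _
  have hk : ∀ y x, 0 ≤ ker f Pw y x (γ x) m ∧ ker f Pw y x (γ x) m ≤ 1 := by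
    intro y x
    unfold ker
    refine ⟨Finset.sum_nonneg fun w _ => ?_, ?_⟩
    · split_ifs
      exacts [hPw0 w, le_rfl]
    · rw [← hPw1]
      refine Finset.sum_le_sum fun w _ => ?_
      split_ifs
      exacts [le_rfl, hPw0 w]
  have hpt : ∀ ω : Fin n → W, ‖fbar f m γ ω - fhat f Pw z γ‖ ≤
      (Fintype.card X : ℝ) * (1 + K1) * ‖m - z‖ + ∑ w, |ehat ω w - Pw w| := by
    intro ω
    have hS : 0 ≤ ∑ w, |ehat ω w - Pw w| := Finset.sum_nonneg fun w _ => abs_nonneg _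
    refine (pi_norm_le_iff_of_nonneg (by positivity)).2 fun y => ?_
    have hdec : (fbar f m γ ω - fhat f Pw z γ) y =
        ∑ x, m x * (∑ w, (if f x (γ x) m w = y then (1:ℝ) else 0) * (ehat ω w - Pw w))
        + ∑ x, (m x - z x) * ker f Pw y x (γ x) m
        + ∑ x, z x * (ker f Pw y x (γ x) m - ker f Pw y x (γ x) z) := by
      rw [← Finset.sum_add_distrib, ← Finset.sum_add_distrib, Pi.sub_apply]
      unfold fbar fhat
      rw [← Finset.sum_sub_distrib]
      refine Finset.sum_congr rfl fun x _ => ?_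
      have e1 : ∑ w, (if f x (γ x) m w = y then (1:ℝ) else 0) * (ehat ω w - Pw w)
          = ∑ w, (if f x (γ x) m w = y then (1:ℝ) else 0) * ehat ω w - ker f Pw y x (γ x) m := by
        unfold ker
        rw [← Finset.sum_sub_distrib]
        refine Finset.sum_congr rfl fun w _ => ?_
        split_ifs <;> ring
      have e2 : ∑ w, (if f x (γ x) m w = y then (1:ℝ) else 0) * m x * ehat ω w
          = m x * ∑ w, (if f x (γ x) m w = y then (1:ℝ) else 0) * ehat ω w := by
        rw [Finset.mul_sum]
        refine Finset.sum_congr rfl fun w _ => ?_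
        ring
      rw [e1, e2]
      ring
    have b1 : |∑ x, m x * (∑ w, (if f x (γ x) m w = y then (1:ℝ) else 0) * (ehat ω w - Pw w))|
        ≤ ∑ w, |ehat ω w - Pw w| := by
      refine (Finset.abs_sum_le_sum_abs _ _).trans ?_
      calc _ ≤ ∑ x, m x * ∑ w, |ehat ω w - Pw w| := by
            refine Finset.sum_le_sum fun x _ => ?_
            rw [abs_mul, abs_of_nonneg (hm.1 x).1]
            refine mul_le_mul_of_nonneg_left ?_ (hm.1 x).1
            refine (Finset.abs_sum_le_sum_abs _ _).trans (Finset.sum_le_sum fun w _ => ?_)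
            split_ifs <;> simp
        _ = _ := by rw [← Finset.sum_mul, hm.2, one_mul]
    have b2 : |∑ x, (m x - z x) * ker f Pw y x (γ x) m| ≤ Fintype.card X * ‖m - z‖ := by
      refine (Finset.abs_sum_le_sum_abs _ _).trans ?_
      calc _ ≤ ∑ x : X, ‖m - z‖ := by
            refine Finset.sum_le_sum fun x _ => ?_
            rw [abs_mul, abs_of_nonneg (hk y x).1]
            have h := norm_le_pi_norm (m - z) x
            rw [Pi.sub_apply, Real.norm_eq_abs] at h
            exact (mul_le_of_le_one_right (abs_nonneg _) (hk y x).2).trans h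
        _ = _ := by simp
    have b3 : |∑ x, z x * (ker f Pw y x (γ x) m - ker f Pw y x (γ x) z)| ≤ K1 * ‖m - z‖ := by
      refine (Finset.abs_sum_le_sum_abs _ _).trans ?_
      calc _ ≤ ∑ x, z x * (K1 * ‖m - z‖) := by
            refine Finset.sum_le_sum fun x _ => ?_
            rw [abs_mul, abs_of_nonneg (hz.1 x).1]
            exact mul_le_mul_of_nonneg_left (hpLip x y (γ x) m z hm.1 hz.1) (hz.1 x).1
        _ = _ := by rw [← Finset.sum_mul, hz.2, one_mul]
    rw [hdec, Real.norm_eq_abs]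
    refine (abs_add_three _ _ _).trans ?_
    have : K1 * ‖m - z‖ ≤ Fintype.card X * (K1 * ‖m - z‖) :=
      le_mul_of_one_le_left (by positivity) hX
    linarith
  calc _ ≤ ∑ ω : Fin n → W, ((∏ i, Pw (ω i)) * ((Fintype.card X : ℝ) * (1 + K1) * ‖m - z‖)
        + ∑ w, (∏ i, Pw (ω i)) * |ehat ω w - Pw w|) := by
        refine Finset.sum_le_sum fun ω _ => ?_
        rw [← Finset.mul_sum, ← mul_add]
        exact mul_le_mul_of_nonneg_left (hpt ω) (Finset.prod_nonneg fun i _ => hPw0 _)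
    _ = (Fintype.card X : ℝ) * (1 + K1) * ‖m - z‖
        + ∑ w, ∑ ω : Fin n → W, (∏ i, Pw (ω i)) * |ehat ω w - Pw w| := by
        rw [Finset.sum_add_distrib, ← Finset.sum_mul, s9_zero Pw hPw1, one_mul, Finset.sum_comm]
    _ ≤ (Fintype.card X : ℝ) * (1 + K1) * ‖m - z‖ + ∑ w : W, 1 / Real.sqrt n := by
        gcongr with w
        exact s9_abs Pw hPw0 hPw1 n hn w
    _ ≤ _ := by
        rw [Finset.sum_const, Finset.card_univ, nsmul_eq_mul, mul_one_div, mul_div_assoc]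
        have : (0:ℝ) ≤ Fintype.card W / Real.sqrt n := by positivity
        linarith [le_mul_of_one_le_left this hX]
end
end
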